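/- arXiv:1806.07255 — 2 statements merged into one kernel-verified Lean document; each statement's English description precedes it below -/
import Mathlib

section
/- Let U and Q be real Hilbert spaces, R : U → Q a continuous linear map, and C := R* ∘ R. Suppose (v_m)_{m∈ℕ} is a Hilbert basis of U of eigenvectors of C with eigenvalues λ_1 ≥ λ_2 ≥ … > 0, and s_m := λ_m^{-1/2} R v_m. For n ∈ ℕ define the truncation R_n by R_n u := Σ_{m=1}^n λ_m^{1/2} ⟪v_m, u⟫ s_m. Then the operator norm of the truncation error equals the next singular value: ‖R − R_n‖ = λ_{n+1}^{1/2}. -/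
open scoped RealInnerProductSpace
open ContinuousLinearMap

/-- Parseval's identity for a map `R` whose Gram operator `R* R` is diagonal in the complete
orthonormal system `v`. -/
theorem hasSum_eigenvalue_mul_inner_sq
    {U Q : Type*} [NormedAddCommGroup U] [InnerProductSpace ℝ U] [CompleteSpace U]
    [NormedAddCommGroup Q] [InnerProductSpace ℝ Q] [CompleteSpace Q]
    {ι : Type*} {R : U →L[ℝ] Q} {v : ι → U} {l : ι → ℝ}
    (hv : Orthonormal ℝ v)
    (hcomplete : (Submodule.span ℝ (Set.range v)).topologicalClosure = ⊤)
    (heig : ∀ m, ((adjoint R) ∘L R) (v m) = l m • v m) (w : U) :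
    HasSum (fun m => l m * ⟪v m, w⟫ ^ 2) (‖R w‖ ^ 2) := by
  have h := (HilbertBasis.mk hv hcomplete.ge).hasSum_inner_mul_inner (((adjoint R) ∘L R) w) w
  have hnorm : ⟪((adjoint R) ∘L R) w, w⟫ = ‖R w‖ ^ 2 := by
    rw [comp_apply, adjoint_inner_left, real_inner_self_eq_norm_sq]
  rw [hnorm] at h
  refine h.congr_fun fun m => ?_
  have hm : ⟪((adjoint R) ∘L R) w, v m⟫ = l m * ⟪v m, w⟫ := by
    rw [← real_inner_smul_left, ← heig m, comp_apply, comp_apply, adjoint_inner_left,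
      adjoint_inner_left, real_inner_comm]
  rw [HilbertBasis.coe_mk, hm]
  ring

/-- The operator norm of the error of the rank-`n` truncated SVD equals the
next singular value `√λ_{n+1}` (with `0`-based indexing, `l n` is the
`(n+1)`-st eigenvalue `λ_{n+1}`). -/
theorem truncation_error_norm
    {U Q : Type*} [NormedAddCommGroup U] [InnerProductSpace ℝ U] [CompleteSpace U]
    [NormedAddCommGroup Q] [InnerProductSpace ℝ Q] [CompleteSpace Q]
    (R : U →L[ℝ] Q) (v : ℕ → U) (l : ℕ → ℝ)
    (hv : Orthonormal ℝ v)
    (hcomplete : (Submodule.span ℝ (Set.range v)).topologicalClosure = ⊤)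
    (heig : ∀ m, ((adjoint R) ∘L R) (v m) = l m • v m)
    (hpos : ∀ m, 0 < l m)
    (hdec : ∀ m, l (m + 1) ≤ l m)
    (n : ℕ) (Rn : U →L[ℝ] Q)
    (hRn : ∀ u : U, Rn u = ∑ m ∈ Finset.range n,
        (Real.sqrt (l m) * ⟪v m, u⟫) • ((Real.sqrt (l m))⁻¹ • R (v m))) :
    ‖R - Rn‖ = Real.sqrt (l n) := by
  have happly (u : U) : (R - Rn) u = R (u - ∑ m ∈ Finset.range n, ⟪v m, u⟫ • v m) := by
    rw [sub_apply, hRn, map_sub, map_sum]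
    congr 1
    refine Finset.sum_congr rfl fun m _ => ?_
    have := (Real.sqrt_pos.2 (hpos m)).ne'
    rw [smul_smul, map_smul]
    congr 1
    field_simp
  have hinner (u : U) (k : ℕ) : ⟪v k, u - ∑ m ∈ Finset.range n, ⟪v m, u⟫ • v m⟫ =
      if k < n then 0 else ⟪v k, u⟫ := by
    simp [inner_sub_right, inner_sum, inner_smul_right, orthonormal_iff_ite.mp hv]
    split_ifs <;> simp
  have hanti : Antitone l := antitone_nat_of_succ_le hdec
  apply le_antisymm
  · refine opNorm_le_bound _ (Real.sqrt_nonneg _) fun u => ?_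
    have hR := hasSum_eigenvalue_mul_inner_sq hv hcomplete heig
      (u - ∑ m ∈ Finset.range n, ⟪v m, u⟫ • v m)
    have hid := (hasSum_eigenvalue_mul_inner_sq (R := .id ℝ U) (l := fun _ => 1) hv hcomplete
      (by simp [adjoint_id]) u).mul_left (l n)
    have hle := hasSum_le (fun k => ?_) hR hid
    · rw [← happly] at hle
      rw [← Real.sqrt_sq (norm_nonneg u), ← Real.sqrt_mul (hpos n).le]
      exact Real.le_sqrt_of_sq_le hle
    · rw [hinner]
      split_ifs with hk
      · have := hpos n
        rw [zero_pow two_ne_zero, mul_zero]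
        positivity
      · rw [one_mul]
        gcongr
        exact hanti (not_lt.mp hk)
  · have hsq : ‖R (v n)‖ ^ 2 = l n := by
      rw [← real_inner_self_eq_norm_sq, ← adjoint_inner_left, ← comp_apply, heig,
        real_inner_smul_left, real_inner_self_eq_norm_sq, hv.1, one_pow, mul_one]
    have hvn : (R - Rn) (v n) = R (v n) := by
      rw [happly, Finset.sum_eq_zero, sub_zero]
      intro m hm
      rw [hv.2 (Finset.mem_range.mp hm).ne, zero_smul]
    rw [← hsq, Real.sqrt_sq (norm_nonneg _), ← hvn]
    simpa [hv.1] using (R - Rn).le_opNorm (v n)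
end

section
/- Let U be a real Hilbert space, (M, Σ, ϖ) a measure space, and r : M → U a Bochner-measurable map with ∫_M ‖r(μ)‖² dϖ(μ) < ∞, and suppose R : U → L²(M, ϖ) is a continuous linear map with (R u)(μ) = ⟪r(μ), u⟫ for ϖ-almost every μ. Then for all φ, ψ ∈ L²(M, ϖ), the operator C_Q := R ∘ R* satisfies ⟪C_Q φ, ψ⟫ = ∬_{M×M} φ(μ₁) · κ(μ₁, μ₂) · ψ(μ₂) dϖ(μ₁) dϖ(μ₂), where κ(μ₁, μ₂) := ⟪r(μ₁), r(μ₂)⟫; i.e. C_Q is the Fredholm integral operator with kernel κ. -/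
open scoped RealInnerProductSpace
open ContinuousLinearMap MeasureTheory

/-- If `R u = ⟪r ·, u⟫` with `r` square-integrable, then `R* ψ = ∫ ψ • r`. -/
theorem adjoint_apply_eq_integral_smul
    {U : Type*} [NormedAddCommGroup U] [InnerProductSpace ℝ U] [CompleteSpace U]
    {M : Type*} [MeasurableSpace M] {ϖ : Measure M} {r : M → U} (hr : MemLp r 2 ϖ)
    (R : U →L[ℝ] Lp ℝ 2 ϖ)
    (hR : ∀ u : U, (R u : M → ℝ) =ᵐ[ϖ] fun μ => ⟪r μ, u⟫) (ψ : Lp ℝ 2 ϖ) :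
    adjoint R ψ = ∫ μ, ψ μ • r μ ∂ϖ := by
  have hint : Integrable (fun μ => ψ μ • r μ) ϖ :=
    memLp_one_iff_integrable.mp (hr.smul (Lp.memLp ψ))
  refine ext_inner_left ℝ fun u => ?_
  rw [adjoint_inner_right, L2.inner_def, ← integral_inner hint]
  refine integral_congr_ae ?_
  filter_upwards [hR u] with μ hμ
  rw [hμ, real_inner_smul_right, real_inner_comm u (r μ)]
  simp

/-- `C_Q = R ∘ R*` is the Fredholm integral operator with kernel
`κ(μ₁, μ₂) = ⟪r(μ₁), r(μ₂)⟫`. -/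
theorem CQ_is_fredholm_integral_operator
    {U : Type*} [NormedAddCommGroup U] [InnerProductSpace ℝ U] [CompleteSpace U]
    {M : Type*} [MeasurableSpace M] (ϖ : Measure M)
    (r : M → U)
    (hmeas : AEStronglyMeasurable r ϖ)
    (hint : Integrable (fun μ => ‖r μ‖ ^ 2) ϖ)
    (R : U →L[ℝ] Lp ℝ 2 ϖ)
    (hR : ∀ u : U, (R u : M → ℝ) =ᵐ[ϖ] fun μ => ⟪r μ, u⟫) :
    ∀ φ ψ : Lp ℝ 2 ϖ,
      ⟪(R ∘L (adjoint R)) φ, ψ⟫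
        = ∫ μ₁, ∫ μ₂, φ μ₁ * ⟪r μ₁, r μ₂⟫ * ψ μ₂ ∂ϖ ∂ϖ := by
  intro φ ψ
  have hr : MemLp r 2 ϖ := (memLp_two_iff_integrable_sq_norm hmeas).mpr hint
  have hψ : Integrable (fun μ => ψ μ • r μ) ϖ :=
    memLp_one_iff_integrable.mp (hr.smul (Lp.memLp ψ))
  rw [comp_apply, ← adjoint_inner_right, adjoint_inner_left, L2.inner_def]
  refine integral_congr_ae ?_
  filter_upwards [hR (adjoint R ψ)] with μ hμ
  rw [hμ, adjoint_apply_eq_integral_smul hr R hR ψ, ← integral_inner hψ]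
  simp only [mul_assoc, integral_const_mul, real_inner_smul_right]
  simp [mul_comm]
end
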